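/- arXiv:1801.09565 — 2 statements merged into one kernel-verified Lean document; each statement's English description precedes it below -/
import Mathlib

section
/- Let u : ℝ² → ℝ² be smooth, compactly supported and divergence-free, and let θ : ℝ² → ℝ² be smooth. Then Σ_{i,k=1}^{2} ∫_{ℝ²} u_i(x) ∂_i θ_k(x) Δθ_k(x) dx = −Σ_{i,j,k=1}^{2} ∫_{ℝ²} ∂_j u_i(x) ∂_i θ_k(x) ∂_j θ_k(x) dx, where Δθ_k = ∂₁₁θ_k + ∂₂₂θ_k. -/
open MeasureTheory

noncomputable section

/-- Partial derivative of a real-valued function on `ℝ²` in the `i`-th coordinate direction. -/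
def pderivE (g : (Fin 2 → ℝ) → ℝ) (i : Fin 2) (x : Fin 2 → ℝ) : ℝ :=
  fderiv ℝ g x (Pi.single i 1)

/-- The Navier–Stokes trilinear form
`b(u,v,w) = ∑ i j, ∫ u_i ∂_i v_j w_j`. -/
def formB (u v w : (Fin 2 → ℝ) → (Fin 2 → ℝ)) : ℝ :=
  ∑ i : Fin 2, ∑ j : Fin 2, ∫ x : Fin 2 → ℝ, u x i * pderivE (fun y => v y j) i x * w x j

/-- The Ericksen stress trilinear form
`m(θ₁,θ₂,u) = −∑ i j k, ∫ ∂_i θ₁^k ∂_j θ₂^k ∂_j u^i`. -/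
def formM (t1 t2 u : (Fin 2 → ℝ) → (Fin 2 → ℝ)) : ℝ :=
  -∑ i : Fin 2, ∑ j : Fin 2, ∑ k : Fin 2, ∫ x : Fin 2 → ℝ,
    pderivE (fun y => t1 y k) i x * pderivE (fun y => t2 y k) j x *
      pderivE (fun y => u y i) j x

/-- `u` is divergence-free: `∂₁u₁ + ∂₂u₂ = 0` everywhere. -/
def DivergenceFree (u : (Fin 2 → ℝ) → (Fin 2 → ℝ)) : Prop :=
  ∀ x, (∑ i : Fin 2, pderivE (fun y => u y i) i x) = 0

/-- The `L²` norm of an `ℝ²`-valued map. -/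
def l2norm (g : (Fin 2 → ℝ) → (Fin 2 → ℝ)) : ℝ :=
  (∫ x : Fin 2 → ℝ, ∑ k : Fin 2, (g x k) ^ 2) ^ (1/2 : ℝ)

/-- The `L²` norm of the gradient of an `ℝ²`-valued map. -/
def gradNorm (g : (Fin 2 → ℝ) → (Fin 2 → ℝ)) : ℝ :=
  (∫ x : Fin 2 → ℝ, ∑ i : Fin 2, ∑ k : Fin 2, (pderivE (fun y => g y k) i x) ^ 2) ^ (1/2 : ℝ)

/-- The `L²` norm of a real-valued function. -/
def l2normR (g : (Fin 2 → ℝ) → ℝ) : ℝ :=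
  (∫ x : Fin 2 → ℝ, (g x) ^ 2) ^ (1/2 : ℝ)

/-- The `L²` norm of the gradient of a real-valued function. -/
def gradNormR (g : (Fin 2 → ℝ) → ℝ) : ℝ :=
  (∫ x : Fin 2 → ℝ, ∑ i : Fin 2, (pderivE g i x) ^ 2) ^ (1/2 : ℝ)

/-- The `k`-th component of the (componentwise) Laplacian `Δg_k = ∂₁₁ g_k + ∂₂₂ g_k`. -/
def lapComp (g : (Fin 2 → ℝ) → (Fin 2 → ℝ)) (k : Fin 2) (x : Fin 2 → ℝ) : ℝ :=
  ∑ i : Fin 2, pderivE (pderivE (fun y => g y k) i) i x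

/-- The `L²` norm of the componentwise Laplacian. -/
def lapNorm (g : (Fin 2 → ℝ) → (Fin 2 → ℝ)) : ℝ :=
  (∫ x : Fin 2 → ℝ, ∑ k : Fin 2, (lapComp g k x) ^ 2) ^ (1/2 : ℝ)

/-- The `L^{4N+2}` norm of an `ℝ²`-valued map (written using `|v|^{4N+2} = (|v|²)^{2N+1}`). -/
def lqNorm (N : ℕ) (g : (Fin 2 → ℝ) → (Fin 2 → ℝ)) : ℝ :=
  (∫ x : Fin 2 → ℝ, (∑ k : Fin 2, (g x k) ^ 2) ^ (2 * N + 1)) ^ (1 / (4 * (N:ℝ) + 2))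

/-- The polynomial nonlinearity `f(θ) = (∑_{j=0}^{N} b_j |θ|^{2j}) θ`. -/
def polyF (N : ℕ) (b : Fin (N + 1) → ℝ) (v : Fin 2 → ℝ) : Fin 2 → ℝ :=
  fun k => (∑ j : Fin (N + 1), b j * (∑ l : Fin 2, (v l) ^ 2) ^ (j : ℕ)) * v k

theorem ContDiff.pderivE {g : (Fin 2 → ℝ) → ℝ} {n m : WithTop ℕ∞} (hg : ContDiff ℝ n g)
    (hmn : m + 1 ≤ n) (i : Fin 2) : ContDiff ℝ m (pderivE g i) :=
  (hg.fderiv_right hmn).clm_apply contDiff_const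

theorem HasCompactSupport.pderivE {g : (Fin 2 → ℝ) → ℝ} (hg : HasCompactSupport g) (i : Fin 2) :
    HasCompactSupport (pderivE g i) :=
  hg.fderiv_apply ℝ _

theorem pderivE_mul {f g : (Fin 2 → ℝ) → ℝ} {x : Fin 2 → ℝ} (hf : DifferentiableAt ℝ f x)
    (hg : DifferentiableAt ℝ g x) (i : Fin 2) :
    pderivE (fun y => f y * g y) i x = pderivE f i x * g x + f x * pderivE g i x := by
  simp only [pderivE, fderiv_fun_mul hf hg, add_apply,
    smul_apply, smul_eq_mul]
  ring

/-- Second partial derivatives of a `C²` function commute. -/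
theorem pderivE_pderivE_comm {g : (Fin 2 → ℝ) → ℝ} (hg : ContDiff ℝ 2 g) (i j : Fin 2) :
    pderivE (pderivE g i) j = pderivE (pderivE g j) i := by
  have key (i j : Fin 2) (x : Fin 2 → ℝ) : pderivE (pderivE g i) j x =
      fderiv ℝ (fderiv ℝ g) x (Pi.single j 1) (Pi.single i 1) := by
    have hd : DifferentiableAt ℝ (fderiv ℝ g) x :=
      ((hg.fderiv_right (m := 1) (by norm_num)).differentiable one_ne_zero) x
    change fderiv ℝ (fun y => fderiv ℝ g y (Pi.single i 1)) x (Pi.single j 1) = _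
    rw [fderiv_clm_apply hd (differentiableAt_const _)]
    simp
  ext x
  rw [key, key]
  exact (hg.contDiffAt.isSymmSndFDerivAt (by simp)).eq _ _

theorem integrable_mul_mul {a b c : (Fin 2 → ℝ) → ℝ} (ha : Continuous a)
    (has : HasCompactSupport a) (hb : Continuous b) (hc : Continuous c) :
    Integrable fun x => a x * b x * c x :=
  ((ha.mul hb).mul hc).integrable_of_hasCompactSupport has.mul_right.mul_right

/-- Integration by parts for a product of three functions, one of them compactly supported. -/
theorem integral_mul_mul_pderivE {a b c : (Fin 2 → ℝ) → ℝ} (ha : ContDiff ℝ 1 a)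
    (has : HasCompactSupport a) (hb : ContDiff ℝ 1 b) (hc : ContDiff ℝ 1 c) (j : Fin 2) :
    ∫ x, a x * b x * pderivE c j x =
      -(∫ x, pderivE a j x * b x * c x) - ∫ x, a x * pderivE b j x * c x := by
  have hda := (ha.pderivE (m := 0) (by norm_num) j).continuous
  have hdb := (hb.pderivE (m := 0) (by norm_num) j).continuous
  have hdc := (hc.pderivE (m := 0) (by norm_num) j).continuous
  have hi₁ := integrable_mul_mul hda (has.pderivE j) hb.continuous hc.continuous
  have hi₂ := integrable_mul_mul ha.continuous has hdb hc.continuous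
  have hprod (x : Fin 2 → ℝ) : pderivE (fun y => a y * b y) j x * c x =
      pderivE a j x * b x * c x + a x * pderivE b j x * c x := by
    rw [pderivE_mul (ha.differentiable one_ne_zero x) (hb.differentiable one_ne_zero x)]
    ring
  have hparts : ∫ x, a x * b x * pderivE c j x =
      -∫ x, pderivE (fun y => a y * b y) j x * c x :=
    integral_mul_fderiv_eq_neg_fderiv_mul_of_integrable
      ((hi₁.add hi₂).congr (.of_forall fun x => (hprod x).symm))
      (integrable_mul_mul ha.continuous has hb.continuous hdc)
      (integrable_mul_mul ha.continuous has hb.continuous hc.continuous)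
      (fun x _ => (ha.mul hb).differentiable one_ne_zero x)
      (fun x _ => hc.differentiable one_ne_zero x)
  rw [hparts, integral_congr_ae (.of_forall hprod), integral_add hi₁ hi₂]
  ring

/-- Convection by a divergence-free field is antisymmetric: `∑ i, ∫ w_i ∂_i h h = 0`. -/
theorem sum_integral_mul_pderivE_mul_self {w : Fin 2 → (Fin 2 → ℝ) → ℝ} {h : (Fin 2 → ℝ) → ℝ}
    (hw : ∀ i, ContDiff ℝ 1 (w i)) (hws : ∀ i, HasCompactSupport (w i))
    (hdiv : ∀ x, ∑ i, pderivE (w i) i x = 0) (hh : ContDiff ℝ 1 h) :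
    ∑ i, ∫ x, w i x * pderivE h i x * h x = 0 := by
  have hparts (i : Fin 2) : 2 * ∫ x, w i x * pderivE h i x * h x =
      -∫ x, pderivE (w i) i x * h x * h x := by
    have := integral_mul_mul_pderivE (hw i) (hws i) hh hh i
    simp only [mul_right_comm _ (h _) (pderivE h i _)] at this
    linarith
  have hzero : ∑ i, ∫ x, pderivE (w i) i x * h x * h x = 0 := by
    rw [← integral_finsetSum _ fun i _ => integrable_mul_mul
      ((hw i).pderivE (m := 0) (by norm_num) i).continuous ((hws i).pderivE i)
      hh.continuous hh.continuous]
    simp [← Finset.sum_mul, hdiv]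
  have := Finset.sum_congr rfl fun i (_ : i ∈ Finset.univ) => hparts i
  rw [← Finset.mul_sum, Finset.sum_neg_distrib, hzero] at this
  linarith

/-- The cancellation identity for a scalar function:
`∑ i, ∫ w_i ∂_i g Δg = -∑ i j, ∫ ∂_j w_i ∂_i g ∂_j g`. -/
theorem sum_integral_mul_pderivE_mul_laplacian {w : Fin 2 → (Fin 2 → ℝ) → ℝ}
    {g : (Fin 2 → ℝ) → ℝ} (hw : ∀ i, ContDiff ℝ 1 (w i)) (hws : ∀ i, HasCompactSupport (w i))
    (hdiv : ∀ x, ∑ i, pderivE (w i) i x = 0) (hg : ContDiff ℝ 2 g) :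
    ∑ i, ∫ x, w i x * pderivE g i x * ∑ j, pderivE (pderivE g j) j x =
      -∑ i, ∑ j, ∫ x, pderivE (w i) j x * pderivE g i x * pderivE g j x := by
  have hdg (i : Fin 2) : ContDiff ℝ 1 (pderivE g i) := hg.pderivE (by norm_num) i
  have hexpand (i : Fin 2) :
      ∫ x, w i x * pderivE g i x * ∑ j, pderivE (pderivE g j) j x =
        ∑ j, (-(∫ x, pderivE (w i) j x * pderivE g i x * pderivE g j x) -
          ∫ x, w i x * pderivE (pderivE g j) i x * pderivE g j x) := by
    simp only [Finset.mul_sum]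
    rw [integral_finsetSum _ fun j _ => integrable_mul_mul (hw i).continuous (hws i)
      (hdg i).continuous ((hdg j).pderivE (m := 0) (by norm_num) j).continuous]
    refine Finset.sum_congr rfl fun j _ => ?_
    rw [integral_mul_mul_pderivE (hw i) (hws i) (hdg i) (hdg j), pderivE_pderivE_comm hg i j]
  have hzero : ∑ i, ∑ j, ∫ x, w i x * pderivE (pderivE g j) i x * pderivE g j x = 0 := by
    rw [Finset.sum_comm]
    exact Finset.sum_eq_zero fun j _ => sum_integral_mul_pderivE_mul_self hw hws hdiv (hdg j)
  simp only [hexpand, Finset.sum_sub_distrib, Finset.sum_neg_distrib, hzero, sub_zero]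

/-- the cancellation identity
`∑_{i,k} ∫ u_i ∂_i θ_k Δθ_k = −∑_{i,j,k} ∫ ∂_j u_i ∂_i θ_k ∂_j θ_k`. -/
theorem convection_laplacian_identity (u θ : (Fin 2 → ℝ) → (Fin 2 → ℝ))
    (hu : ContDiff ℝ (⊤ : ℕ∞) u) (hus : HasCompactSupport u) (hdiv : DivergenceFree u)
    (hθ : ContDiff ℝ (⊤ : ℕ∞) θ) :
    (∑ i : Fin 2, ∑ k : Fin 2, ∫ x : Fin 2 → ℝ,
        u x i * pderivE (fun y => θ y k) i x * lapComp θ k x) =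
      -∑ i : Fin 2, ∑ j : Fin 2, ∑ k : Fin 2, ∫ x : Fin 2 → ℝ,
        pderivE (fun y => u y i) j x * pderivE (fun y => θ y k) i x *
          pderivE (fun y => θ y k) j x := by
  have hw (i : Fin 2) : ContDiff ℝ 1 fun y => u y i :=
    (contDiff_pi.1 hu i).of_le (by exact_mod_cast le_top)
  have hws (i : Fin 2) : HasCompactSupport fun y => u y i :=
    hus.comp_left (g := fun v : Fin 2 → ℝ => v i) rfl
  have hg (k : Fin 2) : ContDiff ℝ 2 fun y => θ y k :=
    (contDiff_pi.1 hθ k).of_le (by exact WithTop.coe_le_coe.2 le_top)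
  have key (k : Fin 2) := sum_integral_mul_pderivE_mul_laplacian hw hws hdiv (hg k)
  rw [Finset.sum_comm]
  simp only [lapComp, key, Finset.sum_neg_distrib]
  rw [Finset.sum_comm]
  exact congrArg _ (Finset.sum_congr rfl fun i _ => Finset.sum_comm)

end
end

section
/- For every κ₁ > 0 there exists a constant C(κ₁) > 0, depending only on κ₁, N and the coefficients b₀,…,b_N, such that for all smooth compactly supported maps θ₁, θ₂ : ℝ² → ℝ², |∫_{ℝ²} (f(θ₁(x)) − f(θ₂(x)))·(θ₁(x) − θ₂(x)) dx| ≤ κ₁ ‖∇(θ₁−θ₂)‖₂² + C(κ₁) ‖θ₁−θ₂‖₂² (1 + ‖θ₁‖_{L^{4N+2}}^{2N} + ‖θ₂‖_{L^{4N+2}}^{2N})². -/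
open MeasureTheory

noncomputable section

/-- Cauchy–Schwarz for nonnegative continuous functions with compact support. -/
theorem integral_mul_le_sqrt_mul_sqrt {f g : (Fin 2 → ℝ) → ℝ} (hf : Continuous f)
    (hf' : HasCompactSupport f) (hg : Continuous g) (hg' : HasCompactSupport g)
    (hf0 : ∀ x, 0 ≤ f x) (hg0 : ∀ x, 0 ≤ g x) :
    ∫ x, f x * g x ≤ √(∫ x, f x ^ 2) * √(∫ x, g x ^ 2) := by
  have h := integral_mul_le_Lp_mul_Lq_of_nonneg (μ := (volume : Measure (Fin 2 → ℝ)))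
    Real.HolderConjugate.two_two (Filter.Eventually.of_forall hf0)
    (Filter.Eventually.of_forall hg0) (hf.memLp_of_hasCompactSupport hf')
    (hg.memLp_of_hasCompactSupport hg')
  simpa only [Real.sqrt_eq_rpow, Real.rpow_two] using h

theorem opNorm_le_sum_abs_apply_single (L : (Fin 2 → ℝ) →L[ℝ] ℝ) :
    ‖L‖ ≤ ∑ i : Fin 2, |L (Pi.single i 1)| := by
  refine L.opNorm_le_bound (Finset.sum_nonneg fun _ _ => abs_nonneg _) fun v => ?_
  have hv : v = ∑ i : Fin 2, v i • (Pi.single i 1 : Fin 2 → ℝ) := by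
    ext k; fin_cases k <;> simp
  calc ‖L v‖ = ‖∑ i : Fin 2, v i * L (Pi.single i 1)‖ := by
        conv_lhs => rw [hv, map_sum]
        simp only [map_smul, smul_eq_mul]
    _ ≤ ∑ i : Fin 2, ‖v i * L (Pi.single i 1)‖ := norm_sum_le _ _
    _ ≤ ∑ i : Fin 2, |L (Pi.single i 1)| * ‖v‖ := by
        refine Finset.sum_le_sum fun i _ => ?_
        rw [norm_mul, mul_comm, Real.norm_eq_abs (L _)]
        gcongr
        exact norm_le_pi_norm v i
    _ = _ := by rw [Finset.sum_mul]

theorem norm_fderiv_sum_sq_le {w : (Fin 2 → ℝ) → (Fin 2 → ℝ)} (hw : Differentiable ℝ w)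
    (x : Fin 2 → ℝ) :
    ‖fderiv ℝ (fun y => ∑ k : Fin 2, (w y k) ^ 2) x‖ ≤
      √8 * (√(∑ k : Fin 2, (w x k) ^ 2) *
        √(∑ i : Fin 2, ∑ k : Fin 2, (pderivE (fun y => w y k) i x) ^ 2)) := by
  have hk : ∀ k, HasFDerivAt (fun y => w y k) (fderiv ℝ (fun y => w y k) x) x := fun k =>
    (differentiable_pi.1 hw k x).hasFDerivAt
  have hd := HasFDerivAt.fun_sum (u := Finset.univ) fun k _ => (hk k).pow 2
  refine (opNorm_le_sum_abs_apply_single _).trans ?_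
  rw [← Real.sqrt_mul (by positivity), ← Real.sqrt_mul (by positivity)]
  apply Real.le_sqrt_of_sq_le
  rw [hd.fderiv]
  simp only [Fin.sum_univ_two, pderivE, add_apply,
    smul_apply, smul_eq_mul, nsmul_eq_mul]
  generalize fderiv ℝ (fun y => w y 0) x (Pi.single 0 1) = a
  generalize fderiv ℝ (fun y => w y 0) x (Pi.single 1 1) = c
  generalize fderiv ℝ (fun y => w y 1) x (Pi.single 0 1) = d
  generalize fderiv ℝ (fun y => w y 1) x (Pi.single 1 1) = e
  generalize w x 0 = p
  generalize w x 1 = q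
  norm_num
  have h1 := add_sq_le (a := |2 * p * a + 2 * q * d|) (b := |2 * p * c + 2 * q * e|)
  rw [sq_abs, sq_abs] at h1
  nlinarith [sq_nonneg (p * d - q * a), sq_nonneg (p * e - q * c)]

theorem l2norm_nonneg (w : (Fin 2 → ℝ) → (Fin 2 → ℝ)) : 0 ≤ l2norm w :=
  Real.rpow_nonneg (integral_nonneg fun _ => by positivity) _

theorem gradNorm_nonneg (w : (Fin 2 → ℝ) → (Fin 2 → ℝ)) : 0 ≤ gradNorm w :=
  Real.rpow_nonneg (integral_nonneg fun _ => by positivity) _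

theorem l2norm_sq (w : (Fin 2 → ℝ) → (Fin 2 → ℝ)) :
    l2norm w ^ 2 = ∫ x, ∑ k : Fin 2, (w x k) ^ 2 := by
  rw [l2norm, ← Real.sqrt_eq_rpow, Real.sq_sqrt (integral_nonneg fun _ => by positivity)]

theorem lqNorm_nonneg (N : ℕ) (w : (Fin 2 → ℝ) → (Fin 2 → ℝ)) : 0 ≤ lqNorm N w :=
  Real.rpow_nonneg (integral_nonneg fun _ => by positivity) _

theorem lqNorm_pow (N : ℕ) (w : (Fin 2 → ℝ) → (Fin 2 → ℝ)) :
    lqNorm N w ^ (4 * N + 2) = ∫ x, (∑ k : Fin 2, (w x k) ^ 2) ^ (2 * N + 1) := by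
  rw [lqNorm, ← Real.rpow_mul_natCast (integral_nonneg fun _ => by positivity)]
  push_cast
  rw [one_div_mul_cancel (by positivity), Real.rpow_one]

theorem continuous_sum_sq {w : (Fin 2 → ℝ) → (Fin 2 → ℝ)} (hw : Continuous w) :
    Continuous fun x => ∑ k : Fin 2, (w x k) ^ 2 := by fun_prop

theorem hasCompactSupport_sum_sq {w : (Fin 2 → ℝ) → (Fin 2 → ℝ)} (hw : HasCompactSupport w) :
    HasCompactSupport fun x => ∑ k : Fin 2, (w x k) ^ 2 :=
  hw.comp_left (g := fun v : Fin 2 → ℝ => ∑ k : Fin 2, (v k) ^ 2) (by simp)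

theorem continuous_pderivE {w : (Fin 2 → ℝ) → (Fin 2 → ℝ)} (hw : ContDiff ℝ 1 w) (i k : Fin 2) :
    Continuous (pderivE (fun y => w y k) i) :=
  ((contDiff_pi.1 hw k).continuous_fderiv one_ne_zero).clm_apply continuous_const

theorem hasCompactSupport_pderivE {w : (Fin 2 → ℝ) → (Fin 2 → ℝ)} (hw : HasCompactSupport w)
    (i k : Fin 2) : HasCompactSupport (pderivE (fun y => w y k) i) :=
  (hw.comp_left (g := fun v : Fin 2 → ℝ => v k) rfl).fderiv_apply ℝ _

/-- The Gagliardo–Nirenberg–Sobolev inequality `‖g‖₂ ≤ ‖∇g‖₁` in two dimensions, squared. -/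
theorem integral_sq_le_sq_integral_norm_fderiv {g : (Fin 2 → ℝ) → ℝ} (hg : ContDiff ℝ 1 g)
    (hg' : HasCompactSupport g) (hg0 : ∀ x, 0 ≤ g x) :
    ∫ x, g x ^ 2 ≤ (∫ x, ‖fderiv ℝ g x‖) ^ 2 := by
  have hF : Integrable fun x => fderiv ℝ g x :=
    (hg.continuous_fderiv one_ne_zero).integrable_of_hasCompactSupport (hg'.fderiv ℝ)
  have h2c : Continuous fun x => g x ^ 2 := hg.continuous.pow 2
  have h2s : HasCompactSupport fun x => g x ^ 2 :=
    hg'.comp_left (g := fun r : ℝ => r ^ 2) (zero_pow two_ne_zero)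
  have h2 : Integrable fun x => g x ^ 2 := h2c.integrable_of_hasCompactSupport h2s
  have hp : Real.HolderConjugate (Fintype.card (Fin 2)) 2 := by
    simpa using Real.HolderConjugate.two_two
  have h := lintegral_pow_le_pow_lintegral_fderiv_aux hp hg hg'
  rw [← ENNReal.ofReal_le_ofReal_iff (by positivity),
    ENNReal.ofReal_pow (integral_nonneg fun _ => norm_nonneg _),
    ofReal_integral_norm_eq_lintegral_enorm hF,
    ofReal_integral_eq_lintegral_ofReal h2 (Filter.Eventually.of_forall fun _ => by positivity)]
  simp only [ENNReal.rpow_two] at h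
  refine le_trans (le_of_eq (lintegral_congr fun x => ?_)) h
  rw [ENNReal.ofReal_pow (hg0 x), Real.enorm_eq_ofReal (hg0 x)]

/-- Ladyzhenskaya's inequality `‖w‖₄² ≤ √8 ‖w‖₂ ‖∇w‖₂` in two dimensions. -/
theorem sqrt_integral_sq_sum_sq_le {w : (Fin 2 → ℝ) → (Fin 2 → ℝ)} (hw : ContDiff ℝ 1 w)
    (hw' : HasCompactSupport w) :
    √(∫ x, (∑ k : Fin 2, (w x k) ^ 2) ^ 2) ≤ √8 * (l2norm w * gradNorm w) := by
  have hWc := continuous_sum_sq hw.continuous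
  have hWs := hasCompactSupport_sum_sq hw'
  have hWd : ContDiff ℝ 1 fun x => ∑ k : Fin 2, (w x k) ^ 2 :=
    ContDiff.sum fun k _ => (contDiff_pi.1 hw k).pow 2
  have hDc : Continuous fun x =>
      ∑ i : Fin 2, ∑ k : Fin 2, (pderivE (fun y => w y k) i x) ^ 2 :=
    continuous_finsetSum _ fun i _ => continuous_finsetSum _ fun k _ =>
      (continuous_pderivE hw i k).pow 2
  have hDs : HasCompactSupport fun x =>
      ∑ i : Fin 2, ∑ k : Fin 2, (pderivE (fun y => w y k) i x) ^ 2 := by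
    have h : ∀ i k, HasCompactSupport fun x => (pderivE (fun y => w y k) i x) ^ 2 := fun i k =>
      (hasCompactSupport_pderivE hw' i k).comp_left (g := fun r : ℝ => r ^ 2) (by simp)
    simp only [Fin.sum_univ_two]
    exact ((h 0 0).add (h 0 1)).add ((h 1 0).add (h 1 1))
  have hFi : Integrable fun x => fderiv ℝ (fun y => ∑ k : Fin 2, (w y k) ^ 2) x :=
    (hWd.continuous_fderiv one_ne_zero).integrable_of_hasCompactSupport (hWs.fderiv ℝ)
  have hprod := integral_mul_le_sqrt_mul_sqrt hWc.sqrt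
    (hWs.comp_left (g := Real.sqrt) Real.sqrt_zero) hDc.sqrt
    (hDs.comp_left (g := Real.sqrt) Real.sqrt_zero) (fun _ => Real.sqrt_nonneg _)
    (fun _ => Real.sqrt_nonneg _)
  have hGN := integral_sq_le_sq_integral_norm_fderiv hWd hWs fun _ => by positivity
  refine (Real.sqrt_le_sqrt hGN).trans ?_
  rw [Real.sqrt_sq (integral_nonneg fun _ => norm_nonneg _)]
  calc ∫ x, ‖fderiv ℝ (fun y => ∑ k : Fin 2, (w y k) ^ 2) x‖
      ≤ ∫ x, √8 * (√(∑ k : Fin 2, (w x k) ^ 2) *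
          √(∑ i : Fin 2, ∑ k : Fin 2, (pderivE (fun y => w y k) i x) ^ 2)) := by
        refine integral_mono hFi.norm (Integrable.const_mul ?_ _)
          (norm_fderiv_sum_sq_le (hw.differentiable one_ne_zero))
        exact (hWc.sqrt.mul hDc.sqrt).integrable_of_hasCompactSupport
          ((hWs.comp_left (g := Real.sqrt) Real.sqrt_zero).mul_right)
    _ ≤ √8 * (l2norm w * gradNorm w) := by
        rw [integral_const_mul]
        gcongr
        refine hprod.trans (le_of_eq ?_)
        simp only [l2norm, gradNorm, ← Real.sqrt_eq_rpow]
        congr 2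
        · exact integral_congr_ae (.of_forall fun x => Real.sq_sqrt (by positivity))
        · exact integral_congr_ae (.of_forall fun x => Real.sq_sqrt (by positivity))

theorem pow_le_pow_add_sqrt_div {P c : ℝ} (hP : 0 ≤ P) (hc : 0 < c) (N : ℕ) :
    P ^ N ≤ c ^ (2 * N) + √(P ^ (2 * N + 1)) / c := by
  obtain ⟨r, hr, rfl⟩ : ∃ r, 0 ≤ r ∧ P = r ^ 2 := ⟨√P, Real.sqrt_nonneg _, (Real.sq_sqrt hP).symm⟩
  rw [← pow_mul, pow_right_comm, Real.sqrt_sq (by positivity)]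
  rcases le_total r c with h | h
  · exact (pow_le_pow_left₀ hr h _).trans (le_add_of_nonneg_right (by positivity))
  · refine le_trans ?_ (le_add_of_nonneg_left (by positivity))
    rw [le_div_iff₀ hc, pow_succ]
    gcongr

theorem integral_pow_mul_sum_sq_le (N : ℕ) {t w : (Fin 2 → ℝ) → (Fin 2 → ℝ)} (ht : Continuous t)
    (ht' : HasCompactSupport t) (hw : ContDiff ℝ 1 w) (hw' : HasCompactSupport w) :
    ∫ x, (∑ k : Fin 2, (t x k) ^ 2) ^ N * ∑ k : Fin 2, (w x k) ^ 2 ≤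
      (1 + lqNorm N t ^ (2 * N)) * l2norm w ^ 2 +
        lqNorm N t ^ (2 * N) * (√8 * (l2norm w * gradNorm w)) := by
  set T := lqNorm N t with hT
  have hT0 : 0 ≤ T := lqNorm_nonneg N t
  set c := max 1 T
  have hc : 0 < c := zero_lt_one.trans_le (le_max_left _ _)
  have hPc := continuous_sum_sq ht
  have hPs := hasCompactSupport_sum_sq ht'
  have hWc := continuous_sum_sq hw.continuous
  have hWs := hasCompactSupport_sum_sq hw'
  have hSc : Continuous fun x => √((∑ k : Fin 2, (t x k) ^ 2) ^ (2 * N + 1)) := (hPc.pow _).sqrt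
  have hSs : HasCompactSupport fun x => √((∑ k : Fin 2, (t x k) ^ 2) ^ (2 * N + 1)) :=
    hPs.comp_left (g := fun r : ℝ => √(r ^ (2 * N + 1))) (by simp)
  have hWi : Integrable fun x => ∑ k : Fin 2, (w x k) ^ 2 :=
    hWc.integrable_of_hasCompactSupport hWs
  have hSWi : Integrable fun x =>
      √((∑ k : Fin 2, (t x k) ^ 2) ^ (2 * N + 1)) * ∑ k : Fin 2, (w x k) ^ 2 :=
    (hSc.mul hWc).integrable_of_hasCompactSupport hSs.mul_right
  have hc1 : c ^ (2 * N) ≤ 1 + T ^ (2 * N) := by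
    rcases max_choice 1 T with h | h <;> simp only [c, h, one_pow]
    · exact le_add_of_nonneg_right (by positivity)
    · exact le_add_of_nonneg_left zero_le_one
  have hc2 : T ^ (2 * N + 1) / c ≤ T ^ (2 * N) := by
    rw [div_le_iff₀ hc, pow_succ]
    gcongr
    exact le_max_right _ _
  have hCS := integral_mul_le_sqrt_mul_sqrt hSc hSs hWc hWs (fun _ => Real.sqrt_nonneg _)
    (fun _ => by positivity)
  have hS2 : √(∫ x, √((∑ k : Fin 2, (t x k) ^ 2) ^ (2 * N + 1)) ^ 2) = T ^ (2 * N + 1) := by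
    rw [Real.sqrt_eq_iff_mul_self_eq (integral_nonneg fun _ => by positivity) (by positivity),
      ← pow_add, show 2 * N + 1 + (2 * N + 1) = 4 * N + 2 by ring, hT, lqNorm_pow]
    refine integral_congr_ae (.of_forall fun x => ?_)
    exact (Real.sq_sqrt (show 0 ≤ (∑ k : Fin 2, (t x k) ^ 2) ^ (2 * N + 1) by positivity))
  rw [hS2] at hCS
  have hL := sqrt_integral_sq_sum_sq_le hw hw'
  have hLG := mul_nonneg (l2norm_nonneg w) (gradNorm_nonneg w)
  calc ∫ x, (∑ k : Fin 2, (t x k) ^ 2) ^ N * ∑ k : Fin 2, (w x k) ^ 2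
      ≤ ∫ x, (c ^ (2 * N) * (∑ k : Fin 2, (w x k) ^ 2) +
          c⁻¹ * (√((∑ k : Fin 2, (t x k) ^ 2) ^ (2 * N + 1)) * ∑ k : Fin 2, (w x k) ^ 2)) := by
        refine integral_mono
          (((hPc.pow N).mul hWc).integrable_of_hasCompactSupport hWs.mul_left)
          ((hWi.const_mul _).add (hSWi.const_mul _)) fun x => ?_
        have h := mul_le_mul_of_nonneg_right
          (pow_le_pow_add_sqrt_div (P := ∑ k : Fin 2, (t x k) ^ 2) (by positivity) hc N)
          (show 0 ≤ ∑ k : Fin 2, (w x k) ^ 2 by positivity)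
        refine h.trans (le_of_eq ?_)
        ring
    _ = c ^ (2 * N) * l2norm w ^ 2 + c⁻¹ *
          ∫ x, √((∑ k : Fin 2, (t x k) ^ 2) ^ (2 * N + 1)) * ∑ k : Fin 2, (w x k) ^ 2 := by
        rw [integral_add (hWi.const_mul _) (hSWi.const_mul _), integral_const_mul,
          integral_const_mul, l2norm_sq]
    _ ≤ c ^ (2 * N) * l2norm w ^ 2 +
          c⁻¹ * (T ^ (2 * N + 1) * (√8 * (l2norm w * gradNorm w))) := by
        gcongr
        exact hCS.trans (by gcongr)
    _ = c ^ (2 * N) * l2norm w ^ 2 +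
          T ^ (2 * N + 1) / c * (√8 * (l2norm w * gradNorm w)) := by ring
    _ ≤ _ := by gcongr

theorem pow_sub_pow_mul_sub_nonneg {X Y : ℝ} (hX : 0 ≤ X) (hY : 0 ≤ Y) (j : ℕ) :
    0 ≤ (X ^ j - Y ^ j) * (X - Y) := by
  rcases le_total X Y with h | h
  · exact mul_nonneg_of_nonpos_of_nonpos (sub_nonpos.2 (pow_le_pow_left₀ hX h j)) (sub_nonpos.2 h)
  · exact mul_nonneg (sub_nonneg.2 (pow_le_pow_left₀ hY h j)) (sub_nonneg.2 h)

theorem pow_sub_pow_mul_sub_le {X Y W : ℝ} (hX : 0 ≤ X) (hY : 0 ≤ Y) (hW : 0 ≤ W)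
    (h : (X - Y) ^ 2 ≤ 2 * (X + Y) * W) (j : ℕ) :
    (X ^ j - Y ^ j) * (X - Y) ≤ 2 * j * (X ^ j + Y ^ j) * W := by
  induction j with
  | zero => simp
  | succ j ih =>
    have h0 := pow_sub_pow_mul_sub_nonneg hX hY j
    have hs : 0 ≤ X ^ j + Y ^ j := by positivity
    have h1 := mul_le_mul_of_nonneg_right ih (add_nonneg hX hY)
    have h2 := mul_le_mul_of_nonneg_left h hs
    have h3 : (X ^ j + Y ^ j) * (X + Y) ≤ 2 * (X ^ (j + 1) + Y ^ (j + 1)) := by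
      rw [pow_succ, pow_succ]; linarith
    have h4 := mul_le_mul_of_nonneg_right h3 (show 0 ≤ (j + 1) * W by positivity)
    push_cast
    rw [pow_succ, pow_succ] at *
    linarith

theorem pow_le_one_add_pow {X : ℝ} (hX : 0 ≤ X) {j N : ℕ} (h : j ≤ N) : X ^ j ≤ 1 + X ^ N := by
  rcases le_total X 1 with h1 | h1
  · exact (pow_le_one₀ hX h1).trans (le_add_of_nonneg_right (by positivity))
  · exact (pow_le_pow_right₀ h1 h).trans (le_add_of_nonneg_left zero_le_one)

/-- For `j ≤ N`, `|(|u|^{2j} u - |v|^{2j} v)·(u - v)|` is bounded by a constant times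
`(1 + |u|^{2N} + |v|^{2N}) |u - v|²`. -/
theorem abs_monomial_inner_le (u v : Fin 2 → ℝ) {j N : ℕ} (h : j ≤ N) :
    |∑ k : Fin 2, ((∑ l : Fin 2, (u l) ^ 2) ^ j * u k - (∑ l : Fin 2, (v l) ^ 2) ^ j * v k) *
        (u k - v k)| ≤
      (2 * j + 1) * (2 * (1 + (∑ l : Fin 2, (u l) ^ 2) ^ N + (∑ l : Fin 2, (v l) ^ 2) ^ N)) *
        ∑ k : Fin 2, (u k - v k) ^ 2 := by
  set X := ∑ l : Fin 2, (u l) ^ 2 with hXd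
  set Y := ∑ l : Fin 2, (v l) ^ 2 with hYd
  set W := ∑ k : Fin 2, (u k - v k) ^ 2 with hWd
  have hX : 0 ≤ X := by positivity
  have hY : 0 ≤ Y := by positivity
  have hW : 0 ≤ W := by positivity
  have hs : 0 ≤ X ^ j + Y ^ j := by positivity
  have hid : ∑ k : Fin 2, (X ^ j * u k - Y ^ j * v k) * (u k - v k) =
      ((X ^ j + Y ^ j) * W + (X ^ j - Y ^ j) * (X - Y)) / 2 := by
    generalize X ^ j = s
    generalize Y ^ j = t
    simp only [hXd, hYd, hWd, Fin.sum_univ_two]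
    ring
  have hXY : (X - Y) ^ 2 ≤ 2 * (X + Y) * W := by
    have e1 : 2 * (X + Y) * W - (X - Y) ^ 2 = W ^ 2 +
        ((u 0 - v 0) * (u 1 + v 1) - (u 1 - v 1) * (u 0 + v 0)) ^ 2 := by
      simp only [hXd, hYd, hWd, Fin.sum_univ_two]; ring
    nlinarith [sq_nonneg W, sq_nonneg ((u 0 - v 0) * (u 1 + v 1) - (u 1 - v 1) * (u 0 + v 0))]
  have h0 := pow_sub_pow_mul_sub_nonneg hX hY j
  have h1 := pow_sub_pow_mul_sub_le hX hY hW hXY j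
  have hsW := mul_nonneg hs hW
  have hj : (0 : ℝ) ≤ j := j.cast_nonneg
  rw [hid, abs_of_nonneg (by positivity)]
  calc ((X ^ j + Y ^ j) * W + (X ^ j - Y ^ j) * (X - Y)) / 2
      ≤ (2 * j + 1) * (X ^ j + Y ^ j) * W := by nlinarith [mul_nonneg hj hsW]
    _ ≤ _ := by
        gcongr
        have := pow_le_one_add_pow hX h
        have := pow_le_one_add_pow hY h
        have : 0 ≤ X ^ N := by positivity
        have : 0 ≤ Y ^ N := by positivity
        linarith

theorem abs_polyF_inner_le (N : ℕ) (b : Fin (N + 1) → ℝ) (hb : ∀ j, 0 ≤ b j) (u v : Fin 2 → ℝ) :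
    |∑ k : Fin 2, (polyF N b u k - polyF N b v k) * (u k - v k)| ≤
      (∑ j : Fin (N + 1), b j * (2 * (2 * ((j : ℕ) : ℝ) + 1))) *
        ((1 + (∑ l : Fin 2, (u l) ^ 2) ^ N + (∑ l : Fin 2, (v l) ^ 2) ^ N) *
          ∑ k : Fin 2, (u k - v k) ^ 2) := by
  have h : ∑ k : Fin 2, (polyF N b u k - polyF N b v k) * (u k - v k) =
      ∑ j : Fin (N + 1), b j * ∑ k : Fin 2, ((∑ l : Fin 2, (u l) ^ 2) ^ (j : ℕ) * u k -
        (∑ l : Fin 2, (v l) ^ 2) ^ (j : ℕ) * v k) * (u k - v k) := by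
    simp only [polyF, Finset.mul_sum, Finset.sum_mul, ← Finset.sum_sub_distrib]
    rw [Finset.sum_comm]
    refine Finset.sum_congr rfl fun j _ => Finset.sum_congr rfl fun k _ => ?_
    ring
  rw [h, Finset.sum_mul]
  refine (Finset.abs_sum_le_sum_abs _ _).trans (Finset.sum_le_sum fun j _ => ?_)
  rw [abs_mul, abs_of_nonneg (hb j), mul_assoc]
  refine mul_le_mul_of_nonneg_left
    ((abs_monomial_inner_le u v (Nat.lt_succ_iff.1 j.2)).trans (le_of_eq ?_)) (hb j)
  ring

/-- estimate (2.17) of the paper: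
`|∫ (f(θ₁) − f(θ₂))·(θ₁ − θ₂)| ≤ κ₁‖∇(θ₁−θ₂)‖₂² + C(κ₁)‖θ₁−θ₂‖₂²(1 + ‖θ₁‖_{L^{4N+2}}^{2N} + ‖θ₂‖_{L^{4N+2}}^{2N})²`. -/
theorem polyF_monotonicity_estimate (N : ℕ) (b : Fin (N + 1) → ℝ) (hb : ∀ j, 0 < b j) :
    ∀ κ₁ > (0:ℝ), ∃ C > (0:ℝ), ∀ t1 t2 : (Fin 2 → ℝ) → (Fin 2 → ℝ),
      ContDiff ℝ (⊤ : ℕ∞) t1 → HasCompactSupport t1 →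
      ContDiff ℝ (⊤ : ℕ∞) t2 → HasCompactSupport t2 →
      |∫ x : Fin 2 → ℝ, ∑ k : Fin 2,
          (polyF N b (t1 x) k - polyF N b (t2 x) k) * (t1 x k - t2 x k)| ≤
        κ₁ * (gradNorm (t1 - t2)) ^ 2 +
          C * (l2norm (t1 - t2)) ^ 2 *
            (1 + (lqNorm N t1) ^ (2 * N) + (lqNorm N t2) ^ (2 * N)) ^ 2 := by
  intro κ hκ
  set K := ∑ j : Fin (N + 1), b j * (2 * (2 * ((j : ℕ) : ℝ) + 1))
  have hK0 : 0 < K :=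
    Finset.sum_pos (fun j _ => mul_pos (hb j) (by positivity)) Finset.univ_nonempty
  refine ⟨3 * K + 2 * K ^ 2 / κ, by positivity, fun t1 t2 h1 h1' h2 h2' => ?_⟩
  have hw : ContDiff ℝ 1 (t1 - t2) := (h1.sub h2).of_le (by exact_mod_cast le_top)
  have hw' : HasCompactSupport (t1 - t2) := h1'.sub h2'
  have hb1 := integral_pow_mul_sum_sq_le N h1.continuous h1' hw hw'
  have hb2 := integral_pow_mul_sum_sq_le N h2.continuous h2' hw hw'
  have hWc := continuous_sum_sq hw.continuous
  have hWs := hasCompactSupport_sum_sq hw'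
  have hWi : Integrable fun x => ∑ k : Fin 2, ((t1 - t2) x k) ^ 2 :=
    hWc.integrable_of_hasCompactSupport hWs
  have hi : ∀ t : (Fin 2 → ℝ) → (Fin 2 → ℝ), Continuous t → Integrable fun x =>
      (∑ k : Fin 2, (t x k) ^ 2) ^ N * ∑ k : Fin 2, ((t1 - t2) x k) ^ 2 := fun t ht =>
    (((continuous_sum_sq ht).pow N).mul hWc).integrable_of_hasCompactSupport hWs.mul_left
  have hi1 := hi t1 h1.continuous
  have hi2 := hi t2 h2.continuous
  have hmain : |∫ x : Fin 2 → ℝ, ∑ k : Fin 2,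
      (polyF N b (t1 x) k - polyF N b (t2 x) k) * (t1 x k - t2 x k)| ≤
      K * (l2norm (t1 - t2) ^ 2 +
        (∫ x, (∑ k : Fin 2, (t1 x k) ^ 2) ^ N * ∑ k : Fin 2, ((t1 - t2) x k) ^ 2) +
        ∫ x, (∑ k : Fin 2, (t2 x k) ^ 2) ^ N * ∑ k : Fin 2, ((t1 - t2) x k) ^ 2) := by
    have hI := hWi.add hi1
    simp only [Pi.add_def] at hI
    rw [l2norm_sq, ← integral_add hWi hi1, ← integral_add hI hi2, ← integral_const_mul,
      ← Real.norm_eq_abs]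
    refine norm_integral_le_of_norm_le ((hI.add hi2).const_mul K)
      (.of_forall fun x => ?_)
    refine (abs_polyF_inner_le N b (fun j => (hb j).le) (t1 x) (t2 x)).trans (le_of_eq ?_)
    simp only [Pi.sub_apply]
    ring
  set L := l2norm (t1 - t2)
  set G := gradNorm (t1 - t2)
  have hL : 0 ≤ L := l2norm_nonneg _
  have hG : 0 ≤ G := gradNorm_nonneg _
  have hA1 : 0 ≤ lqNorm N t1 ^ (2 * N) := pow_nonneg (lqNorm_nonneg N t1) _
  have hA2 : 0 ≤ lqNorm N t2 ^ (2 * N) := pow_nonneg (lqNorm_nonneg N t2) _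
  generalize lqNorm N t1 ^ (2 * N) = A1 at *
  generalize lqNorm N t2 ^ (2 * N) = A2 at *
  set A := 1 + A1 + A2 with hA
  have hA1' : 1 ≤ A := by linarith
  refine hmain.trans ?_
  have hAA : A ≤ A ^ 2 := by nlinarith
  have hX : 0 ≤ √8 * (L * G) := by positivity
  have hsum : K * (L ^ 2 + ((1 + A1) * L ^ 2 + A1 * (√8 * (L * G))) +
      ((1 + A2) * L ^ 2 + A2 * (√8 * (L * G)))) ≤
      K * (3 * A * L ^ 2 + A * (√8 * (L * G))) := by
    refine mul_le_mul_of_nonneg_left ?_ hK0.le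
    rw [hA]
    nlinarith [mul_nonneg hA1 (sq_nonneg L), mul_nonneg hA2 (sq_nonneg L)]
  have hY : K * (A * (√8 * (L * G))) ≤ κ * G ^ 2 + 2 * K ^ 2 / κ * L ^ 2 * A ^ 2 := by
    have h8 : √8 ^ 2 = 8 := Real.sq_sqrt (by norm_num)
    have e : κ * G ^ 2 + 2 * K ^ 2 / κ * L ^ 2 * A ^ 2 - K * (A * (√8 * (L * G))) =
        κ * (G - √8 * K * A * L / (2 * κ)) ^ 2 := by
      field_simp
      ring_nf
      rw [h8]
    have : 0 ≤ κ * (G - √8 * K * A * L / (2 * κ)) ^ 2 := by positivity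
    linarith
  have hZ : K * (3 * A * L ^ 2) ≤ 3 * K * L ^ 2 * A ^ 2 := by
    nlinarith [mul_nonneg (mul_nonneg hK0.le (sq_nonneg L)) (sub_nonneg.2 hAA)]
  calc _ ≤ K * (L ^ 2 + ((1 + A1) * L ^ 2 + A1 * (√8 * (L * G))) +
      ((1 + A2) * L ^ 2 + A2 * (√8 * (L * G)))) := by gcongr
    _ ≤ κ * G ^ 2 + (3 * K + 2 * K ^ 2 / κ) * L ^ 2 * A ^ 2 := by linarith

end
end
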